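/- Let k ∈ ℤ, a ∈ ℕ, and let f : ℍ → ℂ be smooth. Then L_{−k}^a(τ ↦ v^k · conj(f(τ))) = τ ↦ v^{k+2a} · conj((R_k^a f)(τ)) and R_{−k}^a(τ ↦ v^k · conj(f(τ))) = τ ↦ v^{k−2a} · conj((L_k^a f)(τ)), where conj denotes complex conjugation. -/

import Mathlib

open Complex

noncomputable section

/-- The upper half-plane, as a subset of `ℂ`. -/
def UH : Set ℂ := {z : ℂ | 0 < z.im}

/-- Partial derivative in the direction of the real axis, `∂f/∂u`. -/
noncomputable def du (f : ℂ → ℂ) (z : ℂ) : ℂ := fderiv ℝ f z 1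

/-- Partial derivative in the direction of the imaginary axis, `∂f/∂v`. -/
noncomputable def dv (f : ℂ → ℂ) (z : ℂ) : ℂ := fderiv ℝ f z Complex.I

/-- The Wirtinger derivative `∂_τ f = (1/2)(∂f/∂u − i ∂f/∂v)`. -/
noncomputable def dtau (f : ℂ → ℂ) (z : ℂ) : ℂ :=
  (1 / 2) * (du f z - Complex.I * dv f z)

/-- The Wirtinger derivative `∂_τ̄ f = (1/2)(∂f/∂u + i ∂f/∂v)`. -/
noncomputable def dtauBar (f : ℂ → ℂ) (z : ℂ) : ℂ :=
  (1 / 2) * (du f z + Complex.I * dv f z)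

/-- The Maass raising operator `R_k f = 2i ∂_τ f + (k/v) f`. -/
noncomputable def Rop (k : ℤ) (f : ℂ → ℂ) (z : ℂ) : ℂ :=
  2 * Complex.I * dtau f z + ((k : ℂ) / (z.im : ℂ)) * f z

/-- The Maass lowering operator `L_k f = −2i v² ∂_τ̄ f`. -/
noncomputable def Lop (_k : ℤ) (f : ℂ → ℂ) (z : ℂ) : ℂ :=
  -2 * Complex.I * (z.im : ℂ) ^ 2 * dtauBar f z

/-- The weight-`k` hyperbolic Laplacian
`Δ_k f = −v²(∂²f/∂u² + ∂²f/∂v²) + i k v (∂f/∂u + i ∂f/∂v)`. -/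
noncomputable def Lap (k : ℤ) (f : ℂ → ℂ) (z : ℂ) : ℂ :=
  -(z.im : ℂ) ^ 2 * (du (du f) z + dv (dv f) z)
    + Complex.I * (k : ℂ) * (z.im : ℂ) * (du f z + Complex.I * dv f z)

/-- Iterated raising operator `R_k^r = R_{k+2(r−1)} ∘ ⋯ ∘ R_{k+2} ∘ R_k`, `R_k^0 = id`. -/
noncomputable def Riter (k : ℤ) : ℕ → (ℂ → ℂ) → ℂ → ℂ
  | 0, f => f
  | r + 1, f => Rop (k + 2 * (r : ℤ)) (Riter k r f)

/-- Iterated lowering operator `L_k^r = L_{k−2(r−1)} ∘ ⋯ ∘ L_{k−2} ∘ L_k`, `L_k^0 = id`. -/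
noncomputable def Liter (k : ℤ) : ℕ → (ℂ → ℂ) → ℂ → ℂ
  | 0, f => f
  | r + 1, f => Lop (k - 2 * (r : ℤ)) (Liter k r f)

lemma isOpen_UH : IsOpen UH := isOpen_lt continuous_const Complex.continuous_im

lemma hasFDerivAt_im_zpow (m : ℤ) {z : ℂ} (hz : z ∈ UH) :
    HasFDerivAt (fun w : ℂ => (w.im : ℂ) ^ m)
      (((m : ℂ) * (z.im : ℂ) ^ (m - 1)) • (Complex.ofRealCLM.comp Complex.imCLM)) z := by
  have hv : (z.im : ℂ) ≠ 0 := Complex.ofReal_ne_zero.mpr (ne_of_gt hz)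
  exact (hasDerivAt_zpow m (z.im : ℂ) (Or.inl hv)).comp_hasFDerivAt (𝕜 := ℝ) (x := z)
    (f := fun w : ℂ => (w.im : ℂ)) (Complex.ofRealCLM.comp Complex.imCLM).hasFDerivAt

lemma hasFDerivAt_im_zpow_mul_conj (m : ℤ) {g : ℂ → ℂ} {z : ℂ} (hz : z ∈ UH)
    (hg : DifferentiableAt ℝ g z) :
    HasFDerivAt (fun w : ℂ => (w.im : ℂ) ^ m * (starRingEnd ℂ) (g w))
      ((z.im : ℂ) ^ m • ((Complex.conjCLE : ℂ →L[ℝ] ℂ).comp (fderiv ℝ g z)) +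
        (starRingEnd ℂ) (g z) •
          (((m : ℂ) * (z.im : ℂ) ^ (m - 1)) • (Complex.ofRealCLM.comp Complex.imCLM))) z :=
  (hasFDerivAt_im_zpow m hz).mul
    ((Complex.conjCLE : ℂ →L[ℝ] ℂ).hasFDerivAt.comp z hg.hasFDerivAt)

lemma du_im_zpow_mul_conj (m : ℤ) {g : ℂ → ℂ} {z : ℂ} (hz : z ∈ UH)
    (hg : DifferentiableAt ℝ g z) :
    du (fun w : ℂ => (w.im : ℂ) ^ m * (starRingEnd ℂ) (g w)) z
      = (z.im : ℂ) ^ m * (starRingEnd ℂ) (du g z) := by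
  simp [du, (hasFDerivAt_im_zpow_mul_conj m hz hg).fderiv]

lemma dv_im_zpow_mul_conj (m : ℤ) {g : ℂ → ℂ} {z : ℂ} (hz : z ∈ UH)
    (hg : DifferentiableAt ℝ g z) :
    dv (fun w : ℂ => (w.im : ℂ) ^ m * (starRingEnd ℂ) (g w)) z
      = (z.im : ℂ) ^ m * (starRingEnd ℂ) (dv g z)
        + (starRingEnd ℂ) (g z) * (m * (z.im : ℂ) ^ (m - 1)) := by
  simp [dv, (hasFDerivAt_im_zpow_mul_conj m hz hg).fderiv]

lemma Lop_im_zpow_mul_conj (l m : ℤ) {g : ℂ → ℂ} {z : ℂ} (hz : z ∈ UH)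
    (hg : DifferentiableAt ℝ g z) :
    Lop l (fun w : ℂ => (w.im : ℂ) ^ m * (starRingEnd ℂ) (g w)) z
      = (z.im : ℂ) ^ (m + 2) * (starRingEnd ℂ) (Rop m g z) := by
  have hv : (z.im : ℂ) ≠ 0 := Complex.ofReal_ne_zero.mpr (ne_of_gt hz)
  simp only [Lop, Rop, dtau, dtauBar, du_im_zpow_mul_conj m hz hg, dv_im_zpow_mul_conj m hz hg,
    map_add, map_sub, map_mul, map_div₀, map_one, map_ofNat, map_intCast, Complex.conj_I,
    Complex.conj_ofReal, zpow_sub_one₀ hv, zpow_add₀ hv]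
  field_simp
  ring_nf
  simp only [Complex.I_sq]
  ring

lemma Rop_im_zpow_mul_conj (l m : ℤ) {g : ℂ → ℂ} {z : ℂ} (hz : z ∈ UH)
    (hg : DifferentiableAt ℝ g z) :
    Rop (-m) (fun w : ℂ => (w.im : ℂ) ^ m * (starRingEnd ℂ) (g w)) z
      = (z.im : ℂ) ^ (m - 2) * (starRingEnd ℂ) (Lop l g z) := by
  have hv : (z.im : ℂ) ≠ 0 := Complex.ofReal_ne_zero.mpr (ne_of_gt hz)
  simp only [Lop, Rop, dtau, dtauBar, du_im_zpow_mul_conj m hz hg, dv_im_zpow_mul_conj m hz hg,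
    map_add, map_neg, map_mul, map_pow, map_div₀, map_one, map_ofNat, Complex.conj_I,
    Complex.conj_ofReal, zpow_sub_one₀ hv, zpow_sub₀ hv, Int.cast_neg]
  field_simp
  ring_nf
  simp only [Complex.I_sq]
  ring

lemma Filter.EventuallyEq.Rop_eq {f g : ℂ → ℂ} {z : ℂ} (h : f =ᶠ[nhds z] g) (l : ℤ) :
    Rop l f z = Rop l g z := by
  simp only [Rop, dtau, du, dv, h.fderiv_eq, h.eq_of_nhds]

lemma Filter.EventuallyEq.Lop_eq {f g : ℂ → ℂ} {z : ℂ} (h : f =ᶠ[nhds z] g) (l : ℤ) :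
    Lop l f z = Lop l g z := by
  simp only [Lop, dtauBar, du, dv, h.fderiv_eq]

lemma ContDiffOn.fderiv_apply_UH {f : ℂ → ℂ} (hf : ContDiffOn ℝ (⊤ : ℕ∞) f UH) (w : ℂ) :
    ContDiffOn ℝ (⊤ : ℕ∞) (fun z => fderiv ℝ f z w) UH :=
  (hf.fderiv_of_isOpen (m := (⊤ : ℕ∞)) isOpen_UH (by simp)).clm_apply contDiffOn_const

lemma contDiff_ofReal_im : ContDiff ℝ (⊤ : ℕ∞) (fun z : ℂ => (z.im : ℂ)) :=
  (Complex.ofRealCLM.comp Complex.imCLM).contDiff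

lemma ContDiffOn.Rop {f : ℂ → ℂ} (hf : ContDiffOn ℝ (⊤ : ℕ∞) f UH) (k : ℤ) :
    ContDiffOn ℝ (⊤ : ℕ∞) (Rop k f) UH := by
  have hu := hf.fderiv_apply_UH 1
  have hw := hf.fderiv_apply_UH Complex.I
  have hinv : ContDiffOn ℝ (⊤ : ℕ∞) (fun z : ℂ => (k : ℂ) / (z.im : ℂ)) UH := by
    simp only [div_eq_mul_inv]
    exact contDiffOn_const.mul (contDiff_ofReal_im.contDiffOn.inv
      fun z hz => Complex.ofReal_ne_zero.mpr (ne_of_gt hz))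
  exact (contDiffOn_const.mul (contDiffOn_const.mul (hu.sub (contDiffOn_const.mul hw)))).add
    (hinv.mul hf)

lemma ContDiffOn.Lop {f : ℂ → ℂ} (hf : ContDiffOn ℝ (⊤ : ℕ∞) f UH) (k : ℤ) :
    ContDiffOn ℝ (⊤ : ℕ∞) (Lop k f) UH := by
  have hu := hf.fderiv_apply_UH 1
  have hw := hf.fderiv_apply_UH Complex.I
  exact (contDiffOn_const.mul (contDiff_ofReal_im.contDiffOn.pow 2)).mul
    (contDiffOn_const.mul (hu.add (contDiffOn_const.mul hw)))

lemma ContDiffOn.Riter {f : ℂ → ℂ} (hf : ContDiffOn ℝ (⊤ : ℕ∞) f UH) (k : ℤ) (r : ℕ) :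
    ContDiffOn ℝ (⊤ : ℕ∞) (Riter k r f) UH := by
  induction r with
  | zero => exact hf
  | succ r ih => exact ih.Rop _

lemma ContDiffOn.Liter {f : ℂ → ℂ} (hf : ContDiffOn ℝ (⊤ : ℕ∞) f UH) (k : ℤ) (r : ℕ) :
    ContDiffOn ℝ (⊤ : ℕ∞) (Liter k r f) UH := by
  induction r with
  | zero => exact hf
  | succ r ih => exact ih.Lop _

lemma ContDiffOn.differentiableAt_UH {f : ℂ → ℂ} (hf : ContDiffOn ℝ (⊤ : ℕ∞) f UH) {z : ℂ}
    (hz : z ∈ UH) : DifferentiableAt ℝ f z :=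
  (hf.contDiffAt (isOpen_UH.mem_nhds hz)).differentiableAt (by simp)

/-- `L_{−k}^a(v^k conj(f)) = v^{k+2a} conj(R_k^a f)` and
`R_{−k}^a(v^k conj(f)) = v^{k−2a} conj(L_k^a f)`. -/
theorem stmt6 (k : ℤ) (a : ℕ) (f : ℂ → ℂ) (hf : ContDiffOn ℝ (⊤ : ℕ∞) f UH) :
    (∀ z ∈ UH,
      Liter (-k) a (fun w => (w.im : ℂ) ^ k * (starRingEnd ℂ) (f w)) z
        = (z.im : ℂ) ^ (k + 2 * (a : ℤ)) * (starRingEnd ℂ) (Riter k a f z)) ∧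
    (∀ z ∈ UH,
      Riter (-k) a (fun w => (w.im : ℂ) ^ k * (starRingEnd ℂ) (f w)) z
        = (z.im : ℂ) ^ (k - 2 * (a : ℤ)) * (starRingEnd ℂ) (Liter k a f z)) := by
  constructor
  · induction a with
    | zero => simp [Liter, Riter]
    | succ r ih =>
      intro z hz
      have hev := Filter.eventuallyEq_of_mem (isOpen_UH.mem_nhds hz) ih
      simp only [Liter, Riter]
      rw [hev.Lop_eq, Lop_im_zpow_mul_conj _ _ hz ((hf.Riter k r).differentiableAt_UH hz)]
      push_cast
      ring_nf
  · induction a with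
    | zero => simp [Liter, Riter]
    | succ r ih =>
      intro z hz
      have hev := Filter.eventuallyEq_of_mem (isOpen_UH.mem_nhds hz) ih
      simp only [Liter, Riter]
      rw [hev.Rop_eq, show -k + 2 * (r : ℤ) = -(k - 2 * (r : ℤ)) by ring,
        Rop_im_zpow_mul_conj (k - 2 * (r : ℤ)) _ hz ((hf.Liter k r).differentiableAt_UH hz)]
      push_cast
      ring_nf
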